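/- Let G be a subgroup of the symmetric group S_n. Assume that G is primitive (transitive and preserving no nontrivial partition of {1,…,n}) and that G does not contain the natural cycle ζ_n. Then Comp_{n+2}(G) is a subgroup of ⟨δ_{n+2}⟩; that is, every element of Comp_{n+2}(G) is either the identity permutation or the descending permutation δ_{n+2}. -/

import Mathlib

/-- `τ` is an `ℓ`-pattern of `π`: there is a strictly increasing map `f` such that
`τ i < τ j ↔ π (f i) < π (f j)` for all `i, j`. -/
def IsPattern {l n : ℕ} (τ : Equiv.Perm (Fin l)) (π : Equiv.Perm (Fin n)) : Prop :=
  ∃ f : Fin l → Fin n, StrictMono f ∧ ∀ i j : Fin l, τ i < τ j ↔ π (f i) < π (f j)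

/-- `Comp_n(S)`: permutations of degree `n` all of whose `ℓ`-patterns lie in `S`. -/
def Compn (n : ℕ) {l : ℕ} (S : Set (Equiv.Perm (Fin l))) : Set (Equiv.Perm (Fin n)) :=
  {π | ∀ τ : Equiv.Perm (Fin l), IsPattern τ π → τ ∈ S}

/-- The descending permutation `δ_n : i ↦ n + 1 - i` (zero-based: `i ↦ n - 1 - i`). -/
def descPerm (n : ℕ) : Equiv.Perm (Fin n) :=
  Function.Involutive.toPerm Fin.rev fun i => Fin.rev_rev i

/-- The subgroup `G` preserves the partition `P`: every element of `G` maps blocks to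
blocks. -/
def PreservesPartition {n : ℕ} (G : Subgroup (Equiv.Perm (Fin n)))
    (P : Set (Set (Fin n))) : Prop :=
  ∀ π ∈ G, ∀ B ∈ P, π '' B ∈ P

/-- `G` is a transitive subgroup of the symmetric group. -/
def IsTransitiveSubgroup {n : ℕ} (G : Subgroup (Equiv.Perm (Fin n))) : Prop :=
  ∀ x y : Fin n, ∃ g ∈ G, g x = y

/-- `G` is primitive: transitive, and the only partitions it preserves are the trivial
ones (all blocks singletons, or a single block). -/
def IsPrimitiveSubgroup {n : ℕ} (G : Subgroup (Equiv.Perm (Fin n))) : Prop :=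
  IsTransitiveSubgroup G ∧
    ∀ P : Set (Set (Fin n)), Setoid.IsPartition P → PreservesPartition G P →
      (∀ B ∈ P, ∃ x, B = {x}) ∨ P = {Set.univ}

open scoped Pointwise in
theorem IsPrimitiveSubgroup.isPreprimitive {n : ℕ} {G : Subgroup (Equiv.Perm (Fin n))}
    (hG : IsPrimitiveSubgroup G) : MulAction.IsPreprimitive G (Fin n) := by
  have hpre : MulAction.IsPretransitive G (Fin n) := ⟨fun x y => by
    obtain ⟨g, hg, hgx⟩ := hG.1 x y
    exact ⟨⟨g, hg⟩, hgx⟩⟩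
  refine ⟨fun {B} hB => ?_⟩
  rcases B.eq_empty_or_nonempty with rfl | hne
  · exact Or.inl Set.subsingleton_empty
  have hmem : B ∈ Set.range fun g : G => g • B := ⟨1, one_smul _ _⟩
  have hpres : PreservesPartition G (Set.range fun g : G => g • B) := by
    rintro π hπ _ ⟨g, rfl⟩
    exact ⟨⟨π, hπ⟩ * g, mul_smul _ _ _⟩
  rcases hG.2 _ (hB.isBlockSystem hne).1 hpres with h | h
  · obtain ⟨x, hx⟩ := h B hmem
    exact Or.inl (hx ▸ Set.subsingleton_singleton)
  · exact Or.inr (by simpa [h] using hmem)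

theorem IsPattern.trans {k l m : ℕ} {ρ : Equiv.Perm (Fin k)} {τ : Equiv.Perm (Fin l)}
    {π : Equiv.Perm (Fin m)} (h₁ : IsPattern ρ τ) (h₂ : IsPattern τ π) : IsPattern ρ π := by
  obtain ⟨f, hf, hρ⟩ := h₁
  obtain ⟨g, hg, hτ⟩ := h₂
  exact ⟨g ∘ f, hg.comp hf, fun i j => (hρ i j).trans (hτ _ _)⟩

/-- The pattern obtained by deleting the position `k` (and its value) from a permutation. -/
theorem exists_isPattern_succAbove {m : ℕ} (σ : Equiv.Perm (Fin (m + 1))) (k : Fin (m + 1)) :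
    ∃ τ : Equiv.Perm (Fin m), IsPattern τ σ ∧
      ∀ x, (σ k).succAbove (τ x) = σ (k.succAbove x) := by
  have hex : ∀ x : Fin m, ∃ y, (σ k).succAbove y = σ (k.succAbove x) := fun x =>
    Fin.exists_succAbove_eq fun h => k.succAbove_ne x (σ.injective h)
  choose f hf using hex
  have hinj : Function.Injective f := fun x y hxy =>
    Fin.succAbove_right_injective (σ.injective ((hf x).symm.trans (hxy ▸ hf y)))
  refine ⟨Equiv.ofBijective f (Finite.injective_iff_bijective.mp hinj),
    ⟨k.succAbove, Fin.strictMono_succAbove k, fun i j => ?_⟩, hf⟩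
  rw [← hf i, ← hf j, Fin.succAbove_lt_succAbove_iff]
  rfl

theorem Fin.val_succAbove_eq_ite {m : ℕ} (p : Fin (m + 1)) (i : Fin m) :
    (p.succAbove i : ℕ) = if (i : ℕ) < p then (i : ℕ) else i + 1 := by
  unfold Fin.succAbove
  simp only [Fin.lt_def, Fin.val_castSucc]
  split_ifs <;> rfl

/-- Deleting either of two adjacent positions from `σ` yields patterns whose quotient
carries the values left over by one deletion to those left over by the other. -/
theorem exists_mem_succAbove_eq_swap {n : ℕ} {G : Subgroup (Equiv.Perm (Fin n))}
    {σ : Equiv.Perm (Fin (n + 1))} (hσ : σ ∈ Compn (n + 1) (G : Set (Equiv.Perm (Fin n))))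
    (j : Fin n) :
    ∃ ρ ∈ G, ∀ y, (σ j.castSucc).succAbove (ρ y) =
      Equiv.swap (σ j.castSucc) (σ j.succ) ((σ j.succ).succAbove y) := by
  obtain ⟨τ₀, hpat₀, hτ₀⟩ := exists_isPattern_succAbove σ j.castSucc
  obtain ⟨τ₁, hpat₁, hτ₁⟩ := exists_isPattern_succAbove σ j.succ
  refine ⟨τ₀ * τ₁⁻¹, G.mul_mem (hσ _ hpat₀) (G.inv_mem (hσ _ hpat₁)), fun y => ?_⟩
  obtain ⟨x, rfl⟩ := τ₁.surjective y
  rw [Equiv.Perm.mul_apply, ← Equiv.Perm.mul_apply τ₁⁻¹, inv_mul_cancel, Equiv.Perm.one_apply,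
    hτ₀, hτ₁]
  by_cases hx : x = j
  · subst hx
    simp
  · have hsame : j.castSucc.succAbove x = j.succ.succAbove x := by
      ext
      have := Fin.val_ne_of_ne hx
      simp only [Fin.val_succAbove_eq_ite, Fin.val_castSucc, Fin.val_succ]
      split_ifs <;> omega
    rw [hsame, Equiv.swap_apply_of_ne_of_ne]
    · exact fun h => j.castSucc.succAbove_ne x (hsame.trans (σ.injective h))
    · exact fun h => j.succ.succAbove_ne x (σ.injective h)

/-- `ρ` is the descending cycle on the interval `p, …, q - 1`. -/
def IsIntervalCycle {n : ℕ} (ρ : Equiv.Perm (Fin n)) (p q : ℕ) : Prop :=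
  ∀ y, (ρ y : ℕ) = if (y : ℕ) = p then q - 1 else if p < y ∧ (y : ℕ) < q then y - 1 else y

theorem isIntervalCycle_of_succAbove_eq_swap {n : ℕ} {ρ : Equiv.Perm (Fin n)}
    {p q : Fin (n + 1)} (hpq : p < q)
    (h : ∀ y, p.succAbove (ρ y) = Equiv.swap p q (q.succAbove y)) :
    IsIntervalCycle ρ p q := by
  intro y
  have hy := congrArg Fin.val (h y)
  rw [Equiv.swap_apply_def, if_neg (q.succAbove_ne y)] at hy
  simp only [Fin.ext_iff, apply_ite Fin.val, Fin.val_succAbove_eq_ite] at hy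
  rw [Fin.lt_def] at hpq
  split_ifs at hy ⊢ <;> omega

/-- A permutation in `Comp_{n+1}(G)` taking the values `p < q` at adjacent positions
forces the corresponding interval cycle into `G`. -/
theorem exists_mem_isIntervalCycle {n : ℕ} {G : Subgroup (Equiv.Perm (Fin n))}
    {σ : Equiv.Perm (Fin (n + 1))} (hσ : σ ∈ Compn (n + 1) (G : Set (Equiv.Perm (Fin n))))
    {j : Fin n} {p q : Fin (n + 1)} (hpq : p < q)
    (h : σ j.castSucc = p ∧ σ j.succ = q ∨ σ j.castSucc = q ∧ σ j.succ = p) :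
    ∃ ρ ∈ G, IsIntervalCycle ρ p q := by
  obtain ⟨ρ, hρ, hswap⟩ := exists_mem_succAbove_eq_swap hσ j
  rcases h with ⟨hp, hq⟩ | ⟨hq, hp⟩ <;> rw [hp, hq] at hswap
  · exact ⟨ρ, hρ, isIntervalCycle_of_succAbove_eq_swap hpq hswap⟩
  · refine ⟨ρ⁻¹, G.inv_mem hρ, isIntervalCycle_of_succAbove_eq_swap hpq fun y => ?_⟩
    have := hswap (ρ⁻¹ y)
    rw [← Equiv.Perm.mul_apply, mul_inv_cancel, Equiv.Perm.one_apply] at this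
    rw [this, Equiv.swap_comm, Equiv.swap_apply_self]

theorem exists_succAbove_adjacent {n : ℕ} {k : Fin (n + 2)} {i : Fin (n + 1)}
    (h₀ : i.castSucc ≠ k) (h₁ : i.succ ≠ k) :
    ∃ j : Fin n, k.succAbove j.castSucc = i.castSucc ∧ k.succAbove j.succ = i.succ := by
  simp only [ne_eq, Fin.ext_iff, Fin.val_castSucc, Fin.val_succ] at h₀ h₁
  have := i.isLt
  have := k.isLt
  by_cases hik : (i : ℕ) < k
  · refine ⟨⟨i, by omega⟩, ?_, ?_⟩ <;> ext <;>
      simp only [Fin.val_succAbove_eq_ite, Fin.val_castSucc, Fin.val_succ] <;>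
      split_ifs <;> omega
  · refine ⟨⟨i - 1, by omega⟩, ?_, ?_⟩ <;> ext <;>
      simp only [Fin.val_succAbove_eq_ite, Fin.val_castSucc, Fin.val_succ] <;>
      split_ifs <;> omega

/-- If `π ∈ Comp_{n+2}(G)` takes the values `a < b` at adjacent positions, then deleting a
third value `c` gives an interval cycle in `G`. -/
theorem exists_mem_isIntervalCycle_of_delete {n : ℕ} {G : Subgroup (Equiv.Perm (Fin n))}
    {π : Equiv.Perm (Fin (n + 2))} (hπ : π ∈ Compn (n + 2) (G : Set (Equiv.Perm (Fin n))))
    {i : Fin (n + 1)} {a b : Fin (n + 2)}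
    (h : π i.castSucc = a ∧ π i.succ = b ∨ π i.castSucc = b ∧ π i.succ = a)
    {c : Fin (n + 2)} {p q : Fin (n + 1)} (hpq : p < q)
    (hp : c.succAbove p = a) (hq : c.succAbove q = b) :
    ∃ ρ ∈ G, IsIntervalCycle ρ p q := by
  obtain ⟨k, rfl⟩ := π.surjective c
  have hne : ∀ x, π x = a ∨ π x = b → x ≠ k := by
    rintro x (hx | hx) rfl
    · exact (π x).succAbove_ne p (hp.trans hx.symm)
    · exact (π x).succAbove_ne q (hq.trans hx.symm)
  obtain ⟨j, hj₀, hj₁⟩ := exists_succAbove_adjacent (hne i.castSucc (by tauto))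
    (hne i.succ (by tauto))
  obtain ⟨σ, hpat, hσ⟩ := exists_isPattern_succAbove π k
  have h₀ := hσ j.castSucc
  have h₁ := hσ j.succ
  rw [hj₀] at h₀
  rw [hj₁] at h₁
  have hcancel : Function.Injective (π k).succAbove := Fin.succAbove_right_injective
  refine exists_mem_isIntervalCycle (σ := σ) (j := j) (fun τ hτ => hπ τ (hτ.trans hpat)) hpq ?_
  rcases h with ⟨ha, hb⟩ | ⟨hb, ha⟩
  · exact Or.inl ⟨hcancel (by rw [h₀, ha, hp]), hcancel (by rw [h₁, hb, hq])⟩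
  · exact Or.inr ⟨hcancel (by rw [h₀, hb, hq]), hcancel (by rw [h₁, ha, hp])⟩

theorem IsIntervalCycle.finRotate_mem {n : ℕ} {G : Subgroup (Equiv.Perm (Fin n))}
    {ρ : Equiv.Perm (Fin n)} (hρ : ρ ∈ G) (h : IsIntervalCycle ρ 0 n) : finRotate n ∈ G := by
  suffices finRotate n = ρ⁻¹ from this ▸ G.inv_mem hρ
  rw [eq_inv_iff_mul_eq_one]
  ext x
  rw [Equiv.Perm.mul_apply, Equiv.Perm.one_apply]
  obtain _ | m := n
  · exact x.elim0
  have hx := h x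
  have := x.isLt
  rw [coe_finRotate]
  simp only [Fin.ext_iff, Fin.val_last]
  split_ifs at hx ⊢ <;> omega

theorem IsIntervalCycle.isSwap_of_extend_right {n : ℕ} {ρ₁ ρ₂ : Equiv.Perm (Fin n)} {p q : ℕ}
    (hpq : p < q) (hq : q < n) (h₁ : IsIntervalCycle ρ₁ p q)
    (h₂ : IsIntervalCycle ρ₂ p (q + 1)) : (ρ₂ * ρ₁⁻¹).IsSwap := by
  refine ⟨⟨q - 1, by omega⟩, ⟨q, hq⟩, by simp [Fin.ext_iff]; omega, ?_⟩
  rw [mul_inv_eq_iff_eq_mul]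
  ext y
  have hy₁ := h₁ y
  have hy₂ := h₂ y
  rw [Equiv.Perm.mul_apply, Equiv.swap_apply_def]
  simp only [Fin.ext_iff, apply_ite Fin.val]
  split_ifs at hy₁ hy₂ ⊢ <;> omega

theorem IsIntervalCycle.isSwap_of_extend_left {n : ℕ} {ρ₁ ρ₂ : Equiv.Perm (Fin n)} {p q : ℕ}
    (hpq : p + 1 < q) (hq : q ≤ n) (h₁ : IsIntervalCycle ρ₁ (p + 1) q)
    (h₂ : IsIntervalCycle ρ₂ p q) : (ρ₂⁻¹ * ρ₁).IsSwap := by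
  refine ⟨⟨p, by omega⟩, ⟨p + 1, by omega⟩, by simp [Fin.ext_iff], ?_⟩
  rw [inv_mul_eq_iff_eq_mul]
  ext y
  have hy₁ := h₁ y
  have hy₂ := h₂ (Equiv.swap ⟨p, by omega⟩ ⟨p + 1, by omega⟩ y)
  rw [Equiv.Perm.mul_apply, hy₂, hy₁, Equiv.swap_apply_def]
  simp only [Fin.ext_iff, apply_ite Fin.val]
  split_ifs <;> omega

/-- Adjacent positions carrying values at distance at least two force the natural cycle into
a primitive group. -/
theorem finRotate_mem_of_gap {n : ℕ} {G : Subgroup (Equiv.Perm (Fin n))}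
    (hprim : IsPrimitiveSubgroup G) {π : Equiv.Perm (Fin (n + 2))}
    (hπ : π ∈ Compn (n + 2) (G : Set (Equiv.Perm (Fin n)))) {i : Fin (n + 1)}
    {a b : Fin (n + 2)} (hab : (a : ℕ) + 1 < b)
    (h : π i.castSucc = a ∧ π i.succ = b ∨ π i.castSucc = b ∧ π i.succ = a) :
    finRotate n ∈ G := by
  have hb := b.isLt
  have hdelete : ∀ (c p q : ℕ) (_ : c < n + 2) (_ : p < q) (_ : q < n + 1)
      (_ : (if p < c then p else p + 1) = a) (_ : (if q < c then q else q + 1) = b),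
      ∃ ρ ∈ G, IsIntervalCycle ρ p q := fun c p q hc hpq hq hpa hqb =>
    exists_mem_isIntervalCycle_of_delete hπ h (c := ⟨c, hc⟩) (p := ⟨p, by omega⟩)
      (q := ⟨q, hq⟩) hpq (Fin.ext (by rw [Fin.val_succAbove_eq_ite]; exact hpa))
      (Fin.ext (by rw [Fin.val_succAbove_eq_ite]; exact hqb))
  have hswap : ∀ g ∈ G, g.IsSwap → finRotate n ∈ G := fun g hg hgs => by
    rw [Equiv.Perm.subgroup_eq_top_of_isPreprimitive_of_isSwap_mem hprim.isPreprimitive g hgs hg]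
    exact Subgroup.mem_top _
  obtain ⟨ρ₁, hρ₁, h₁⟩ := hdelete (a + 1) a (b - 1) (by omega) (by omega) (by omega)
    (by split_ifs <;> omega) (by split_ifs <;> omega)
  by_cases hbn : (b : ℕ) < n + 1
  · obtain ⟨ρ₂, hρ₂, h₂⟩ := hdelete (b + 1) a b (by omega) (by omega) (by omega)
      (by split_ifs <;> omega) (by split_ifs <;> omega)
    refine hswap _ (G.mul_mem hρ₂ (G.inv_mem hρ₁))
      (h₁.isSwap_of_extend_right (by omega) (by omega) ?_)
    rwa [Nat.sub_add_cancel (by omega)]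
  by_cases ha : (a : ℕ) = 0
  · rw [ha, show (b : ℕ) - 1 = n by omega] at h₁
    exact h₁.finRotate_mem hρ₁
  · obtain ⟨ρ₂, hρ₂, h₂⟩ := hdelete 0 (a - 1) (b - 1) (by omega) (by omega) (by omega)
      (by split_ifs <;> omega) (by split_ifs <;> omega)
    refine hswap _ (G.mul_mem (G.inv_mem hρ₂) hρ₁)
      (IsIntervalCycle.isSwap_of_extend_left (p := a - 1) (q := b - 1) (by omega) (by omega) ?_ h₂)
    rwa [Nat.sub_add_cancel (by omega)]

/-- A permutation whose consecutive values differ by one is monotone. -/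
theorem eq_one_or_eq_descPerm_of_adjacent {m : ℕ} (π : Equiv.Perm (Fin (m + 2)))
    (h : ∀ i : Fin (m + 1), (π i.succ : ℕ) = π i.castSucc + 1 ∨
      (π i.castSucc : ℕ) = π i.succ + 1) :
    π = 1 ∨ π = descPerm (m + 2) := by
  obtain ⟨s, hs, hstep⟩ : ∃ s : ℤ, (s = 1 ∨ s = -1) ∧ (π 1 : ℤ) = π 0 + s := by
    rcases h 0 with h | h <;> simp only [Fin.castSucc_zero, Fin.succ_zero_eq_one] at h
    · exact ⟨1, by simp, by omega⟩
    · exact ⟨-1, by simp, by omega⟩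
  have key : ∀ t : ℕ, ∀ ht : t + 1 < m + 2,
      (π ⟨t, by omega⟩ : ℤ) = π 0 + s * t ∧ (π ⟨t + 1, ht⟩ : ℤ) = π 0 + s * (t + 1) := by
    intro t
    induction t with
    | zero => intro _; exact ⟨by simp, by simpa using hstep⟩
    | succ t ih =>
      intro ht
      obtain ⟨hlo, hhi⟩ := ih (by omega)
      refine ⟨by simpa using hhi, ?_⟩
      have hne : (π ⟨t + 1 + 1, ht⟩ : ℕ) ≠ π ⟨t, by omega⟩ := fun heq => by
        have := congrArg Fin.val (π.injective (Fin.ext heq))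
        simp only at this
        omega
      have hadj := h ⟨t + 1, by omega⟩
      simp only [Fin.succ_mk, Fin.castSucc_mk] at hadj
      push_cast
      rcases hs with rfl | rfl <;> omega
  have hval : ∀ x : Fin (m + 2), (π x : ℤ) = π 0 + s * (x : ℕ) := by
    rintro ⟨_ | t, ht⟩
    · simp
    · simpa using (key t ht).2
  have hlast := hval (Fin.last _)
  have hbound := (π (Fin.last _)).isLt
  have hbound₀ := (π 0).isLt
  simp only [Fin.val_last] at hlast
  rcases hs with rfl | rfl
  · refine Or.inl (Equiv.ext fun x => Fin.ext ?_)
    have := hval x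
    rw [Equiv.Perm.one_apply]
    omega
  · refine Or.inr (Equiv.ext fun x => Fin.ext ?_)
    have := hval x
    change (π x : ℕ) = (Fin.rev x : ℕ)
    rw [Fin.val_rev]
    omega

theorem comp_two_of_primitive_no_cycle {n : ℕ} (hn : 0 < n)
    (G : Subgroup (Equiv.Perm (Fin n))) (hprim : IsPrimitiveSubgroup G)
    (hζ : finRotate n ∉ G) :
    Compn (n + 2) (G : Set (Equiv.Perm (Fin n))) ⊆
      (Subgroup.zpowers (descPerm (n + 2)) : Set (Equiv.Perm (Fin (n + 2)))) := by
  intro π hπ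
  have hadj : ∀ i : Fin (n + 1), (π i.succ : ℕ) = π i.castSucc + 1 ∨
      (π i.castSucc : ℕ) = π i.succ + 1 := by
    intro i
    by_contra hgap
    have hne : (π i.castSucc : ℕ) ≠ π i.succ := fun heq =>
      (Fin.castSucc_lt_succ (i := i)).ne (π.injective (Fin.ext heq))
    refine hζ ?_
    rcases lt_or_gt_of_ne hne with hlt | hlt
    · exact finRotate_mem_of_gap hprim hπ (i := i) (by omega) (Or.inl ⟨rfl, rfl⟩)
    · exact finRotate_mem_of_gap hprim hπ (i := i) (by omega) (Or.inr ⟨rfl, rfl⟩)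
  rcases eq_one_or_eq_descPerm_of_adjacent π hadj with rfl | rfl
  · exact Subgroup.one_mem _
  · exact Subgroup.mem_zpowers _
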